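/- arXiv:2506.07843 — 3 statements merged into one kernel-verified Lean document; each statement's English description precedes it below -/
import Mathlib

section
/- Let d ≥ 1 and k ≥ 1. For each q ∈ {0,1,…,k} let π_q : ℝ^d × ℝ^d → (0,∞) be a measurable, everywhere positive transition kernel density (∫_{ℝ^d} π_q(x,y) dy = 1 for every x), and let U_0, U_k : ℝ^d → ℝ be measurable with Z_0 = ∫_{ℝ^d} e^{-U_0(x)} dx ∈ (0,∞). Define the path density ϱ(x_0,…,x_k) = Z_0^{-1} e^{-U_0(x_0)} ∏_{q=1}^k π_{q-1}(x_{q-1}, x_q) and the weight W(x_0,…,x_k) = e^{-U_k(x_k) + U_0(x_0)} ∏_{q=1}^k π_q(x_q, x_{q-1}) / π_{q-1}(x_{q-1}, x_q). Then for every measurable f : ℝ^d → ℝ with ∫_{ℝ^d} |f(x)| e^{-U_k(x)} dx < ∞, one has ∫_{ℝ^{d(k+1)}} f(x_k) W(x_0,…,x_k) ϱ(x_0,…,x_k) dx_0 ⋯ dx_k = Z_0^{-1} ∫_{ℝ^d} f(x) e^{-U_k(x)} dx. -/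
open MeasureTheory Finset

/-- Integrating a function of the last coordinate of a path against backward transition densities
leaves only the integral of that function. -/
theorem integral_last_mul_prod_backward_density {E : Type*} [MeasureSpace E]
    [SigmaFinite (volume : Measure E)] {g : E → ℝ} (hg : Integrable g) (k : ℕ)
    (κ : ℕ → E → E → ℝ) (hκ : ∀ q, Measurable (fun p : E × E => κ q p.1 p.2))
    (hκ0 : ∀ q x y, 0 ≤ κ q x y) (hκ1 : ∀ q < k, ∀ x, ∫ y, κ q x y = 1) :
    Integrable (fun x : Fin (k + 1) → E =>
      g (x (Fin.last k)) * ∏ q : Fin k, κ q (x q.succ) (x q.castSucc)) ∧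
    ∫ x : Fin (k + 1) → E,
      g (x (Fin.last k)) * ∏ q : Fin k, κ q (x q.succ) (x q.castSucc) = ∫ z, g z := by
  induction k generalizing κ with
  | zero =>
    have h := volume_preserving_funUnique (Fin 1) E
    simp only [univ_eq_empty, prod_empty, mul_one]
    exact ⟨(h.integrable_comp_emb (MeasurableEquiv.measurableEmbedding _)).2 hg,
      h.integral_comp' g⟩
  | succ k ih =>
    obtain ⟨hint, hval⟩ := ih (fun q => κ (q + 1)) (fun q => hκ _) (fun q => hκ0 _)
      (fun q hq => hκ1 _ (by omega))
    set F : (Fin (k + 1) → E) → ℝ := fun x =>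
      g (x (Fin.last k)) * ∏ q : Fin k, κ (q + 1) (x q.succ) (x q.castSucc)
    have h := volume_preserving_piFinSuccAbove (fun _ : Fin (k + 2) => E) 0
    let G : E × (Fin (k + 1) → E) → ℝ := fun p => F p.2 * κ 0 (p.2 0) p.1
    have hG : (fun x : Fin (k + 2) → E =>
        g (x (Fin.last (k + 1))) * ∏ q : Fin (k + 1), κ q (x q.succ) (x q.castSucc)) =
        fun x => G (MeasurableEquiv.piFinSuccAbove (fun _ : Fin (k + 2) => E) 0 x) := by
      funext x
      rw [Fin.prod_univ_succ]
      simp [G, F, MeasurableEquiv.piFinSuccAbove, Fin.insertNthEquiv, Fin.tail]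
      ring
    have hκ0int : ∀ x, Integrable (κ 0 x) := fun x =>
      Integrable.of_integral_ne_zero (by rw [hκ1 0 (by omega) x]; exact one_ne_zero)
    have hκmeas : Measurable (fun p : E × (Fin (k + 1) → E) => κ 0 (p.2 0) p.1) :=
      (hκ 0).comp (f := fun p : E × (Fin (k + 1) → E) => (p.2 0, p.1))
        (by fun_prop)
    have hGint : Integrable G (volume.prod volume) := by
      have hGmeas : AEStronglyMeasurable G (volume.prod volume) :=
        hint.aestronglyMeasurable.comp_snd.mul hκmeas.aestronglyMeasurable
      refine (integrable_prod_iff' hGmeas).2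
        ⟨.of_forall fun y => (hκ0int (y 0)).const_mul (F y), ?_⟩
      refine hint.norm.congr (.of_forall fun y => ?_)
      simp only [G, norm_mul, Real.norm_of_nonneg (hκ0 _ _ _), integral_const_mul,
        hκ1 0 (by omega), mul_one]
    rw [hG]
    refine ⟨(h.integrable_comp_emb (MeasurableEquiv.measurableEmbedding _)).2 hGint, ?_⟩
    rw [h.integral_comp' G, Measure.volume_eq_prod, integral_prod_symm _ hGint, ← hval]
    simp only [G, integral_const_mul, hκ1 0 (by omega), mul_one]

/-- Jarzynski reweighting identity. With transition kernel densities
`π_q` (`q = 0,…,k`), path density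
`ϱ(x_0,…,x_k) = Z_0⁻¹ e^{-U_0(x_0)} ∏_{q=1}^k π_{q-1}(x_{q-1},x_q)` and weight
`W(x_0,…,x_k) = e^{-U_k(x_k)+U_0(x_0)} ∏_{q=1}^k π_q(x_q,x_{q-1})/π_{q-1}(x_{q-1},x_q)`,
for every measurable `f` with `∫ |f| e^{-U_k} < ∞` one has
`∫ f(x_k) W ϱ = Z_0⁻¹ ∫ f e^{-U_k}`.  Paths are `x : Fin (k+1) → ℝ^d`; for `q : Fin k`,
`q.castSucc` is the index `q` and `q.succ` the index `q+1` in the path. -/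
theorem stmt_1 (d k : ℕ) (hd : 1 ≤ d) (hk : 1 ≤ k)
    (π : ℕ → (Fin d → ℝ) → (Fin d → ℝ) → ℝ)
    (hπmeas : ∀ q, Measurable (fun p : (Fin d → ℝ) × (Fin d → ℝ) => π q p.1 p.2))
    (hπpos : ∀ q x y, 0 < π q x y)
    (hπnorm : ∀ q ≤ k, ∀ x, ∫ y : Fin d → ℝ, π q x y = 1)
    (U0 Uk : (Fin d → ℝ) → ℝ) (hU0 : Measurable U0) (hUk : Measurable Uk)
    (hZ0int : Integrable (fun x : Fin d → ℝ => Real.exp (-U0 x)))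
    (hZ0pos : 0 < ∫ x : Fin d → ℝ, Real.exp (-U0 x))
    (ϱ W : (Fin (k + 1) → Fin d → ℝ) → ℝ)
    (hϱ : ∀ x, ϱ x = (∫ z : Fin d → ℝ, Real.exp (-U0 z))⁻¹ * Real.exp (-U0 (x 0)) *
      ∏ q : Fin k, π q (x q.castSucc) (x q.succ))
    (hW : ∀ x, W x = Real.exp (-Uk (x (Fin.last k)) + U0 (x 0)) *
      ∏ q : Fin k, π (q + 1) (x q.succ) (x q.castSucc) / π q (x q.castSucc) (x q.succ))
    (f : (Fin d → ℝ) → ℝ) (hf : Measurable f)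
    (hfint : Integrable (fun x : Fin d → ℝ => |f x| * Real.exp (-Uk x))) :
    ∫ x : Fin (k + 1) → Fin d → ℝ, f (x (Fin.last k)) * W x * ϱ x =
      (∫ z : Fin d → ℝ, Real.exp (-U0 z))⁻¹ * ∫ z : Fin d → ℝ, f z * Real.exp (-Uk z) := by
  have hg : Integrable (fun z : Fin d → ℝ => f z * Real.exp (-Uk z)) :=
    hfint.mono' (hf.mul hUk.neg.exp).aestronglyMeasurable
      (.of_forall fun z => by simp)
  rw [← (integral_last_mul_prod_backward_density hg k (fun q => π (q + 1))
    (fun q => hπmeas _) (fun q x y => (hπpos _ x y).le)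
    (fun q hq => hπnorm _ (by omega))).2, ← integral_const_mul]
  congr 1 with x
  have hP : ∏ q : Fin k, π q (x q.castSucc) (x q.succ) ≠ 0 :=
    prod_ne_zero_iff.2 fun q _ => (hπpos _ _ _).ne'
  have hexp : Real.exp (U0 (x 0)) * Real.exp (-U0 (x 0)) = 1 := by
    rw [← Real.exp_add, add_neg_cancel, Real.exp_zero]
  rw [hW, hϱ, Real.exp_add, prod_div_distrib]
  field_simp
  linear_combination (f (x (Fin.last k)) *
    ∏ q : Fin k, π (q + 1) (x q.succ) (x q.castSucc)) * hexp
end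

section
/- Let d ≥ 1 and k ≥ 1. For each q ∈ {0,1,…,k} let π_q : ℝ^d × ℝ^d → (0,∞) be a measurable, everywhere positive transition kernel density (∫_{ℝ^d} π_q(x,y) dy = 1 for every x), and let U_0, U_k : ℝ^d → ℝ be measurable with Z_0 = ∫ e^{-U_0} ∈ (0,∞) and Z_k = ∫ e^{-U_k} < ∞. With the path density ϱ(x_0,…,x_k) = Z_0^{-1} e^{-U_0(x_0)} ∏_{q=1}^k π_{q-1}(x_{q-1}, x_q) and the weight W(x_0,…,x_k) = e^{-U_k(x_k)+U_0(x_0)} ∏_{q=1}^k π_q(x_q,x_{q-1})/π_{q-1}(x_{q-1},x_q), the expectation of the weight under the path law satisfies the discrete Jarzynski equality: ∫_{ℝ^{d(k+1)}} W(x_0,…,x_k) ϱ(x_0,…,x_k) dx_0 ⋯ dx_k = Z_k / Z_0. -/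
open MeasureTheory Finset

/-- Integrating out the variables of a chain of transition densities, started at the last
coordinate and run backwards, leaves only the integral of the density of that coordinate. -/
theorem lintegral_mul_prod_backward_chain {E : Type*} [MeasurableSpace E] (μ : Measure E)
    [SigmaFinite μ] (n : ℕ) (p : Fin n → E → E → ENNReal)
    (hp : ∀ q, Measurable (fun z : E × E => p q z.1 z.2))
    (hp1 : ∀ q x, ∫⁻ y, p q x y ∂μ = 1) (g : E → ENNReal) (hg : Measurable g) :
    ∫⁻ x : Fin (n + 1) → E, g (x (Fin.last n)) * ∏ q : Fin n, p q (x q.succ) (x q.castSucc)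
      ∂(Measure.pi fun _ => μ) = ∫⁻ x, g x ∂μ := by
  induction n with
  | zero =>
    simp only [Finset.univ_eq_empty, Finset.prod_empty, mul_one]
    convert (measurePreserving_funUnique μ (Fin 1)).lintegral_comp_emb
      (MeasurableEquiv.funUnique (Fin 1) E).measurableEmbedding g
    rfl
  | succ n ih =>
    rw [← ih (fun q => p q.succ) (fun q => hp _) (fun q => hp1 _),
      ← (measurePreserving_piFinSuccAbove (fun _ : Fin (n + 2) => μ) 0).symm.lintegral_comp_emb
        (MeasurableEquiv.measurableEmbedding _)]
    have key : ∀ z : E × (Fin (n + 1) → E),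
        g ((MeasurableEquiv.piFinSuccAbove (fun _ : Fin (n + 2) => E) 0).symm z
            (Fin.last (n + 1))) *
          ∏ q : Fin (n + 1),
            p q ((MeasurableEquiv.piFinSuccAbove (fun _ : Fin (n + 2) => E) 0).symm z q.succ)
              ((MeasurableEquiv.piFinSuccAbove (fun _ : Fin (n + 2) => E) 0).symm z q.castSucc) =
        (g (z.2 (Fin.last n)) *
          ∏ q : Fin n, p q.succ (z.2 q.succ) (z.2 q.castSucc)) * p 0 (z.2 0) z.1 := by
      rintro ⟨a, y⟩
      rw [Fin.prod_univ_succ]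
      simp only [MeasurableEquiv.piFinSuccAbove_symm_apply, Fin.insertNthEquiv_zero,
        Fin.consEquiv_apply, ← Fin.succ_last, ← Fin.succ_castSucc, Fin.cons_succ,
        Fin.castSucc_zero, Fin.cons_zero]
      ring
    have hF : Measurable fun y : Fin (n + 1) → E =>
        g (y (Fin.last n)) * ∏ q : Fin n, p q.succ (y q.succ) (y q.castSucc) :=
      (hg.comp (measurable_pi_apply _)).mul (Finset.measurable_prod _ fun q _ =>
        (hp q.succ).comp (f := fun y : Fin (n + 1) → E => (y q.succ, y q.castSucc))
          ((measurable_pi_apply _).prodMk (measurable_pi_apply _)))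
    have hp0 : Measurable fun z : E × (Fin (n + 1) → E) => p 0 (z.2 0) z.1 :=
      (hp 0).comp (f := fun z : E × (Fin (n + 1) → E) => (z.2 0, z.1))
        (((measurable_pi_apply _).comp measurable_snd).prodMk measurable_fst)
    simp_rw [key]
    refine (lintegral_prod_symm _ ((hF.comp measurable_snd).mul hp0).aemeasurable).trans ?_
    refine lintegral_congr fun y => ?_
    have hpy : Measurable fun a => p 0 (y 0) a := (hp 0).comp measurable_prodMk_left
    simp only [Pi.mul_apply, Function.comp_apply]
    rw [lintegral_const_mul _ hpy, hp1, mul_one]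

/-- Discrete Jarzynski equality.  With the path density `ϱ` and weight `W`
of Jarzynski reweighting, the expectation of the weight under the path law is
`∫ W ϱ = Z_k / Z_0`, where `Z_0 = ∫ e^{-U_0} ∈ (0,∞)` and `Z_k = ∫ e^{-U_k} < ∞`. -/
theorem stmt_2 (d k : ℕ) (hd : 1 ≤ d) (hk : 1 ≤ k)
    (π : ℕ → (Fin d → ℝ) → (Fin d → ℝ) → ℝ)
    (hπmeas : ∀ q, Measurable (fun p : (Fin d → ℝ) × (Fin d → ℝ) => π q p.1 p.2))
    (hπpos : ∀ q x y, 0 < π q x y)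
    (hπnorm : ∀ q ≤ k, ∀ x, ∫ y : Fin d → ℝ, π q x y = 1)
    (U0 Uk : (Fin d → ℝ) → ℝ) (hU0 : Measurable U0) (hUk : Measurable Uk)
    (hZ0int : Integrable (fun x : Fin d → ℝ => Real.exp (-U0 x)))
    (hZ0pos : 0 < ∫ x : Fin d → ℝ, Real.exp (-U0 x))
    (hZkint : Integrable (fun x : Fin d → ℝ => Real.exp (-Uk x)))
    (ϱ W : (Fin (k + 1) → Fin d → ℝ) → ℝ)
    (hϱ : ∀ x, ϱ x = (∫ z : Fin d → ℝ, Real.exp (-U0 z))⁻¹ * Real.exp (-U0 (x 0)) *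
      ∏ q : Fin k, π q (x q.castSucc) (x q.succ))
    (hW : ∀ x, W x = Real.exp (-Uk (x (Fin.last k)) + U0 (x 0)) *
      ∏ q : Fin k, π (q + 1) (x q.succ) (x q.castSucc) / π q (x q.castSucc) (x q.succ)) :
    ∫ x : Fin (k + 1) → Fin d → ℝ, W x * ϱ x =
      (∫ z : Fin d → ℝ, Real.exp (-Uk z)) / (∫ z : Fin d → ℝ, Real.exp (-U0 z)) := by
  have hprod : ∀ x, W x * ϱ x = (∫ z : Fin d → ℝ, Real.exp (-U0 z))⁻¹ *
      (Real.exp (-Uk (x (Fin.last k))) *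
        ∏ q : Fin k, π (q + 1) (x q.succ) (x q.castSucc)) := by
    intro x
    have hne : ∏ q : Fin k, π q (x q.castSucc) (x q.succ) ≠ 0 :=
      Finset.prod_ne_zero_iff.2 fun q _ => (hπpos _ _ _).ne'
    have hexp : Real.exp (U0 (x 0)) * Real.exp (-U0 (x 0)) = 1 := by
      rw [← Real.exp_add, add_neg_cancel, Real.exp_zero]
    rw [hW, hϱ, Finset.prod_div_distrib, Real.exp_add]
    field_simp
    linear_combination (∏ q : Fin k, π (q + 1) (x q.succ) (x q.castSucc)) * hexp
  have hlint : ∀ q ≤ k, ∀ x, ∫⁻ y : Fin d → ℝ, ENNReal.ofReal (π q x y) = 1 := by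
    intro q hq x
    have hint : Integrable fun y : Fin d → ℝ => π q x y := by
      by_contra h
      simpa [integral_undef h] using hπnorm q hq x
    rw [← ofReal_integral_eq_lintegral_ofReal hint (ae_of_all _ fun y => (hπpos q x y).le),
      hπnorm q hq x, ENNReal.ofReal_one]
  have hchain := lintegral_mul_prod_backward_chain (volume : Measure (Fin d → ℝ)) k
    (fun q x y => ENNReal.ofReal (π (q + 1) x y)) (fun q => (hπmeas _).ennreal_ofReal)
    (fun q => hlint _ q.isLt) (fun x => ENNReal.ofReal (Real.exp (-Uk x)))
    hUk.neg.exp.ennreal_ofReal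
  have hmeas : Measurable fun x : Fin (k + 1) → Fin d → ℝ =>
      Real.exp (-Uk (x (Fin.last k))) * ∏ q : Fin k, π (q + 1) (x q.succ) (x q.castSucc) :=
    (hUk.neg.exp.comp (measurable_pi_apply _)).mul (Finset.measurable_prod _ fun q _ =>
      (hπmeas (q + 1)).comp (f := fun x : Fin (k + 1) → Fin d → ℝ => (x q.succ, x q.castSucc))
        ((measurable_pi_apply _).prodMk (measurable_pi_apply _)))
  simp_rw [hprod]
  rw [integral_const_mul, div_eq_inv_mul]
  congr 1
  rw [integral_eq_lintegral_of_nonneg_ae (ae_of_all _ fun x => mul_nonneg (Real.exp_nonneg _)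
      (Finset.prod_nonneg fun q _ => (hπpos _ _ _).le)) hmeas.aestronglyMeasurable,
    integral_eq_lintegral_of_nonneg_ae (ae_of_all _ fun x => Real.exp_nonneg _)
      hZkint.aestronglyMeasurable, ← hchain]
  congr 1
  refine lintegral_congr fun x => ?_
  rw [ENNReal.ofReal_mul (Real.exp_nonneg _),
    ENNReal.ofReal_prod_of_nonneg fun q _ => (hπpos _ _ _).le]
end

section
/- Let d ≥ 1 and k ≥ 1. For each q ∈ {0,1,…,k} let π_q : ℝ^d × ℝ^d → (0,∞) be a measurable, everywhere positive transition kernel density, and let U_0, U_k : ℝ^d → ℝ be measurable with Z_0 = ∫ e^{-U_0} ∈ (0,∞) and Z_k = ∫ e^{-U_k} ∈ (0,∞). Let ϱ and W be the path density and weight as in Jarzynski reweighting: ϱ(x_0,…,x_k) = Z_0^{-1} e^{-U_0(x_0)} ∏_{q=1}^k π_{q-1}(x_{q-1},x_q), W(x_0,…,x_k) = e^{-U_k(x_k)+U_0(x_0)} ∏_{q=1}^k π_q(x_q,x_{q-1})/π_{q-1}(x_{q-1},x_q). Then for every measurable f : ℝ^d → ℝ with ∫ |f| e^{-U_k} < ∞,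 the self-normalized reweighted expectation equals the Boltzmann–Gibbs expectation: (∫ f(x_k) W ϱ dx_0⋯dx_k) / (∫ W ϱ dx_0⋯dx_k) = Z_k^{-1} ∫_{ℝ^d} f(x) e^{-U_k(x)} dx. -/
open MeasureTheory Finset

section BackwardMarkovChain

variable {E : Type*} [MeasurableSpace E]

lemma measurable_prod_backward_transition {k : ℕ} {p : Fin k → E → E → ENNReal}
    (hp : ∀ q, Measurable (Function.uncurry (p q))) :
    Measurable fun x : Fin (k + 1) → E => ∏ q, p q (x q.succ) (x q.castSucc) :=
  Finset.measurable_fun_prod _ fun q _ =>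
    (hp q).comp (f := fun x : Fin (k + 1) → E => (x q.succ, x q.castSucc))
      ((measurable_pi_apply q.succ).prodMk (measurable_pi_apply q.castSucc))

/-- Integrating out all coordinates but the last one of a Markov chain run backwards
in the coordinate index. -/
lemma lintegral_last_mul_prod_backward_transition (μ : Measure E) [SigmaFinite μ] {k : ℕ}
    {p : Fin k → E → E → ENNReal}
    (hp : ∀ q, Measurable (Function.uncurry (p q))) (hp1 : ∀ q x, ∫⁻ y, p q x y ∂μ = 1)
    {g : E → ENNReal} (hg : Measurable g) :
    ∫⁻ x : Fin (k + 1) → E, g (x (Fin.last k)) * ∏ q, p q (x q.succ) (x q.castSucc)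
      ∂Measure.pi (fun _ => μ) = ∫⁻ z, g z ∂μ := by
  induction k with
  | zero =>
    convert (measurePreserving_funUnique μ (Fin 1)).lintegral_comp hg using 2
    · congr!
    · simp
  | succ k ih =>
    have hp' : ∀ q : Fin k, Measurable (Function.uncurry (p q.succ)) := fun q => hp q.succ
    have hG : Measurable fun x : Fin (k + 1) → E =>
        g (x (Fin.last k)) * ∏ q : Fin k, p q.succ (x q.succ) (x q.castSucc) :=
      (hg.comp (measurable_pi_apply _)).mul (measurable_prod_backward_transition hp')
    have hp0 : Measurable fun z : E × (Fin (k + 1) → E) => p 0 (z.2 0) z.1 :=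
      (hp 0).comp (f := fun z : E × (Fin (k + 1) → E) => (z.2 0, z.1))
        (((measurable_pi_apply 0).comp measurable_snd).prodMk measurable_fst)
    have hF : Measurable fun z : E × (Fin (k + 1) → E) =>
        (g (z.2 (Fin.last k)) * ∏ q : Fin k, p q.succ (z.2 q.succ) (z.2 q.castSucc)) *
          p 0 (z.2 0) z.1 := (hG.comp measurable_snd).mul hp0
    calc
      _ = ∫⁻ z : E × (Fin (k + 1) → E),
          (g (z.2 (Fin.last k)) * ∏ q : Fin k, p q.succ (z.2 q.succ) (z.2 q.castSucc)) *
            p 0 (z.2 0) z.1 ∂μ.prod (Measure.pi fun _ => μ) := by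
        rw [← (measurePreserving_piFinSuccAbove (fun _ : Fin (k + 2) => μ) 0).lintegral_comp hF]
        refine lintegral_congr fun x => ?_
        rw [Fin.prod_univ_succ, mul_comm (p 0 _ _), ← mul_assoc]
        rfl
      _ = ∫⁻ x : Fin (k + 1) → E,
          g (x (Fin.last k)) * ∏ q : Fin k, p q.succ (x q.succ) (x q.castSucc)
            ∂Measure.pi (fun _ => μ) := by
        rw [lintegral_prod_symm' _ hF]
        refine lintegral_congr fun x => ?_
        have h : Measurable fun y => p 0 (x 0) y := (hp 0).comp measurable_prodMk_left
        dsimp only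
        rw [lintegral_const_mul _ h, hp1, mul_one]
      _ = ∫⁻ z, g z ∂μ := ih hp' fun q => hp1 q.succ

lemma map_last_withDensity_prod_backward_transition (μ : Measure E) [SigmaFinite μ] {k : ℕ}
    {p : Fin k → E → E → ENNReal}
    (hp : ∀ q, Measurable (Function.uncurry (p q))) (hp1 : ∀ q x, ∫⁻ y, p q x y ∂μ = 1) :
    ((Measure.pi fun _ : Fin (k + 1) => μ).withDensity
      fun x => ∏ q, p q (x q.succ) (x q.castSucc)).map (fun x => x (Fin.last k)) = μ := by
  refine Measure.ext_of_lintegral _ fun g hg => ?_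
  rw [lintegral_map hg (measurable_pi_apply _),
    lintegral_withDensity_eq_lintegral_mul _ (measurable_prod_backward_transition hp)
      (g := fun x => g (x (Fin.last k))) (hg.comp (measurable_pi_apply _)),
    ← lintegral_last_mul_prod_backward_transition μ hp hp1 hg]
  exact lintegral_congr fun x => mul_comm _ _

lemma integral_last_mul_prod_backward_transition (μ : Measure E) [SigmaFinite μ] {k : ℕ}
    {p : Fin k → E → E → ℝ}
    (hp : ∀ q, Measurable (Function.uncurry (p q))) (hp0 : ∀ q x y, 0 ≤ p q x y)
    (hp1 : ∀ q x, ∫ y, p q x y ∂μ = 1) {g : E → ℝ} (hg : Measurable g) :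
    ∫ x : Fin (k + 1) → E, g (x (Fin.last k)) * ∏ q, p q (x q.succ) (x q.castSucc)
      ∂Measure.pi (fun _ => μ) = ∫ z, g z ∂μ := by
  have hq : ∀ q, Measurable (Function.uncurry fun x y => ENNReal.ofReal (p q x y)) :=
    fun q => (hp q).ennreal_ofReal
  have hq1 : ∀ q x, ∫⁻ y, ENNReal.ofReal (p q x y) ∂μ = 1 := fun q x => by
    have hi : Integrable (p q x) μ :=
      Integrable.of_integral_ne_zero (by rw [hp1]; exact one_ne_zero)
    rw [← ofReal_integral_eq_lintegral_ofReal hi (.of_forall (hp0 q x)), hp1,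
      ENNReal.ofReal_one]
  conv_rhs => rw [← map_last_withDensity_prod_backward_transition μ hq hq1]
  rw [integral_map (measurable_pi_apply _).aemeasurable hg.aestronglyMeasurable,
    integral_withDensity_eq_integral_toReal_smul (measurable_prod_backward_transition hq)
      (.of_forall fun x => ENNReal.prod_lt_top fun q _ => ENNReal.ofReal_lt_top)]
  refine integral_congr_ae (.of_forall fun x => ?_)
  simp [ENNReal.toReal_prod, ENNReal.toReal_ofReal (hp0 _ _ _), mul_comm]

end BackwardMarkovChain

/-- Self-normalized Jarzynski reweighting gives Boltzmann–Gibbs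
expectations: `(∫ f(x_k) W ϱ) / (∫ W ϱ) = Z_k⁻¹ ∫ f e^{-U_k}`, for every measurable `f`
with `∫ |f| e^{-U_k} < ∞`, where `Z_0 = ∫ e^{-U_0} ∈ (0,∞)` and `Z_k = ∫ e^{-U_k} ∈ (0,∞)`. -/
theorem stmt_3 (d k : ℕ) (hd : 1 ≤ d) (hk : 1 ≤ k)
    (π : ℕ → (Fin d → ℝ) → (Fin d → ℝ) → ℝ)
    (hπmeas : ∀ q, Measurable (fun p : (Fin d → ℝ) × (Fin d → ℝ) => π q p.1 p.2))
    (hπpos : ∀ q x y, 0 < π q x y)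
    (hπnorm : ∀ q ≤ k, ∀ x, ∫ y : Fin d → ℝ, π q x y = 1)
    (U0 Uk : (Fin d → ℝ) → ℝ) (hU0 : Measurable U0) (hUk : Measurable Uk)
    (hZ0int : Integrable (fun x : Fin d → ℝ => Real.exp (-U0 x)))
    (hZ0pos : 0 < ∫ x : Fin d → ℝ, Real.exp (-U0 x))
    (hZkint : Integrable (fun x : Fin d → ℝ => Real.exp (-Uk x)))
    (hZkpos : 0 < ∫ x : Fin d → ℝ, Real.exp (-Uk x))
    (ϱ W : (Fin (k + 1) → Fin d → ℝ) → ℝ)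
    (hϱ : ∀ x, ϱ x = (∫ z : Fin d → ℝ, Real.exp (-U0 z))⁻¹ * Real.exp (-U0 (x 0)) *
      ∏ q : Fin k, π q (x q.castSucc) (x q.succ))
    (hW : ∀ x, W x = Real.exp (-Uk (x (Fin.last k)) + U0 (x 0)) *
      ∏ q : Fin k, π (q + 1) (x q.succ) (x q.castSucc) / π q (x q.castSucc) (x q.succ))
    (f : (Fin d → ℝ) → ℝ) (hf : Measurable f)
    (hfint : Integrable (fun x : Fin d → ℝ => |f x| * Real.exp (-Uk x))) :
    (∫ x : Fin (k + 1) → Fin d → ℝ, f (x (Fin.last k)) * W x * ϱ x) /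
      (∫ x : Fin (k + 1) → Fin d → ℝ, W x * ϱ x) =
      (∫ z : Fin d → ℝ, Real.exp (-Uk z))⁻¹ * ∫ z : Fin d → ℝ, f z * Real.exp (-Uk z) := by
  have key : ∀ g : (Fin d → ℝ) → ℝ, Measurable g →
      ∫ x : Fin (k + 1) → Fin d → ℝ, g (x (Fin.last k)) * (W x * ϱ x) =
        (∫ z, Real.exp (-U0 z))⁻¹ * ∫ z, g z * Real.exp (-Uk z) := by
    intro g hg
    rw [← integral_last_mul_prod_backward_transition volume
      (p := fun q : Fin k => π (q + 1)) (fun q => hπmeas _) (fun q x y => (hπpos _ x y).le)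
      (fun q => hπnorm _ q.isLt) (g := fun z => g z * Real.exp (-Uk z))
      (hg.mul hUk.neg.exp), ← volume_pi, ← integral_const_mul]
    refine integral_congr_ae (.of_forall fun x => ?_)
    have hne : ∏ q : Fin k, π q (x q.castSucc) (x q.succ) ≠ 0 :=
      Finset.prod_ne_zero_iff.2 fun q _ => (hπpos _ _ _).ne'
    have hexp : Real.exp (U0 (x 0)) * Real.exp (-U0 (x 0)) = 1 := by
      rw [← Real.exp_add, add_neg_cancel, Real.exp_zero]
    simp only [hW, hϱ, Finset.prod_div_distrib, Real.exp_add]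
    field_simp
    linear_combination g (x (Fin.last k)) *
      (∏ q : Fin k, π (q + 1) (x q.succ) (x q.castSucc)) * hexp
  have hnum := key f hf
  have hden := key (fun _ => 1) measurable_const
  simp only [one_mul] at hden
  simp only [mul_assoc, hnum, hden]
  field_simp
end
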